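/- arXiv:1908.08132 — 3 statements merged into one kernel-verified Lean document; each statement's English description precedes it below -/
import Mathlib

section
/- Let N be a positive integer and b : Fin N → ℝ an indicator vector with b i ∈ {0, 1} for all i, and define min₁(x) := min x 1 and δ i j := if i = j then (1:ℝ) else 0. Then the compositional tensor evaluation of the formula ∃x ∀y [R_b(x) ∧ (¬R_b(y) ∨ x = y)], namely V := min₁( ∑ i, (1 - min₁( ∑ j, (1 - (b i) * min₁((1 - b j) + δ i j)))) ), lies in {0, 1}, and V = 1 if and only if there is exactly one index i : Fin N with b i = 1. -/
/-- The truncated sum of indicators is the indicator of the existential quantification. -/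
lemma min_sum_ite_one {ι : Type*} [Fintype ι] (p : ι → Prop) [DecidablePred p]
    [Decidable (∃ i, p i)] :
    min (∑ i, if p i then (1 : ℝ) else 0) 1 = if ∃ i, p i then 1 else 0 := by
  split_ifs with h
  · obtain ⟨i, hi⟩ := h
    refine min_eq_right ?_
    have := Finset.single_le_sum (f := fun i => if p i then (1 : ℝ) else 0)
      (fun j _ => by positivity) (Finset.mem_univ i)
    simpa [hi] using this
  · push Not at h
    simp [h]

/-- The compositional tensor evaluation
`V = min₁(∑ i, 1 - min₁(∑ j, 1 - b i * min₁((1 - b j) + δ i j)))` of the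
formula `∃x ∀y [R_b(x) ∧ (¬R_b(y) ∨ x = y)]` lies in `{0,1}`, and equals `1`
iff there is exactly one index `i` with `b i = 1`. -/
theorem oneB_tensor_evaluation
    (N : ℕ) (hN : 0 < N) (b : Fin N → ℝ) (hb : ∀ i, b i = 0 ∨ b i = 1)
    (δ : Fin N → Fin N → ℝ) (hδ : ∀ i j, δ i j = if i = j then 1 else 0)
    (V : ℝ)
    (hV : V = min (∑ i, (1 - min (∑ j,
        (1 - (b i) * min ((1 - b j) + δ i j) 1)) 1)) 1) :
    (V = 0 ∨ V = 1) ∧ (V = 1 ↔ ∃! i, b i = 1) := by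
  classical
  have hbody (i j : Fin N) : 1 - b i * min ((1 - b j) + δ i j) 1 =
      if ¬(b i = 1 ∧ (b j = 1 → i = j)) then 1 else 0 := by
    rw [hδ]
    by_cases hij : i = j
    · subst hij
      rcases hb i with h | h <;> norm_num [h]
    · rcases hb i with h | h <;> rcases hb j with h' | h' <;> norm_num [h, h', hij]
  have hforall (i : Fin N) : 1 - min (∑ j, (1 - b i * min ((1 - b j) + δ i j) 1)) 1 =
      if b i = 1 ∧ ∀ j, b j = 1 → i = j then 1 else 0 := by
    simp_rw [hbody]
    rw [min_sum_ite_one]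
    have : (∃ j, ¬(b i = 1 ∧ (b j = 1 → i = j))) ↔
        ¬(b i = 1 ∧ ∀ j, b j = 1 → i = j) := by
      have : Nonempty (Fin N) := ⟨i⟩
      rw [← not_forall, forall_and, forall_const]
    simp only [this]
    split_ifs <;> norm_num
  have hexists : V = if ∃! i, b i = 1 then 1 else 0 := by
    rw [hV]
    simp_rw [hforall]
    rw [min_sum_ite_one]
    simp only [ExistsUnique, eq_comm]
  rw [hexists]
  split_ifs with h <;> simp [h]
end

section
/- Let Σ be a type with decidable equality and let l, r : Σ with l ≠ r, and let w : List Σ. Then the first-order dissimilation formula F_diss = ∀x ∀y [(R_l(x) ∧ R_l(y) ∧ x < y) → ∃z (R_r(z) ∧ x < z ∧ z < y)] is true in the precedence model of w — i.e., for all positions i, j : Fin w.length with i < j, w.get i = l and w.get j = l, there exists a position k with i < k, k < j and w.get k = r — if and only if every block of w.splitOnP (· = r) (every maximal segment of w containing no occurrence of r) contains at most one occurrence of l. -/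
namespace List

/-- Any two occurrences of `l` in `w` have an occurrence of `r` strictly between them. -/
def Dissimilated {α : Type*} (l r : α) (w : List α) : Prop :=
  ∀ i j : ℕ, i < j → w[i]? = some l → w[j]? = some l → ∃ k, i < k ∧ k < j ∧ w[k]? = some r

/-- Every occurrence of `l` in `w` comes after some occurrence of `r`. -/
def Preceded {α : Type*} (l r : α) (w : List α) : Prop :=
  ∀ j : ℕ, w[j]? = some l → ∃ k, k < j ∧ w[k]? = some r

theorem preceded_cons {α : Type*} {l r : α} (hlr : l ≠ r) (x : α) (w : List α) :
    Preceded l r (x :: w) ↔ x = r ∨ x ≠ l ∧ Preceded l r w := by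
  constructor
  · intro h
    refine or_iff_not_imp_left.2 fun hx => ⟨fun hl => ?_, fun j hj => ?_⟩
    · obtain ⟨k, hk, -⟩ := h 0 (by simp [hl])
      omega
    · obtain ⟨k, hk, hr⟩ := h (j + 1) (by simpa using hj)
      cases k with
      | zero => simp [hx] at hr
      | succ k => exact ⟨k, by omega, by simpa using hr⟩
  · rintro h (_ | j) hj
    · have hx : x = l := by simpa using hj
      rcases h with h | h
      · exact absurd (hx.symm.trans h) hlr
      · exact absurd hx h.1
    · rcases h with h | h
      · exact ⟨0, by omega, by simp [h]⟩
      · obtain ⟨k, hk, hr⟩ := h.2 j (by simpa using hj)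
        exact ⟨k + 1, by omega, by simpa using hr⟩

theorem dissimilated_cons {α : Type*} {l r : α} (x : α) (w : List α) :
    Dissimilated l r (x :: w) ↔ (x = l → Preceded l r w) ∧ Dissimilated l r w := by
  constructor
  · intro h
    refine ⟨fun hx j hj => ?_, fun i j hij hi hj => ?_⟩
    · obtain ⟨k, hk, hkj, hr⟩ := h 0 (j + 1) (by omega) (by simp [hx]) (by simpa using hj)
      obtain ⟨k, rfl⟩ := Nat.exists_eq_add_one.2 hk
      exact ⟨k, by omega, by simpa using hr⟩
    · obtain ⟨k, hk, hkj, hr⟩ :=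
        h (i + 1) (j + 1) (by omega) (by simpa using hi) (by simpa using hj)
      obtain ⟨k, rfl⟩ := Nat.exists_eq_add_one.2 (show 0 < k by omega)
      exact ⟨k, by omega, by omega, by simpa using hr⟩
  · rintro ⟨hp, hd⟩ i j hij hi hj
    obtain ⟨j, rfl⟩ := Nat.exists_eq_add_one.2 (show 0 < j by omega)
    cases i with
    | zero =>
      obtain ⟨k, hk, hr⟩ := hp (by simpa using hi) j (by simpa using hj)
      exact ⟨k + 1, by omega, by omega, by simpa using hr⟩
    | succ i =>
      obtain ⟨k, hk, hkj, hr⟩ := hd i j (by omega) (by simpa using hi) (by simpa using hj)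
      exact ⟨k + 1, by omega, by omega, by simpa using hr⟩

theorem exists_splitOnP_eq_cons_of_ne {α : Type*} [DecidableEq α] {l r : α} (hlr : l ≠ r)
    (w : List α) :
    ∃ h t, w.splitOnP (· = r) = h :: t ∧ (Preceded l r w ↔ h.count l = 0) ∧
      (Dissimilated l r w ↔ ∀ s ∈ h :: t, s.count l ≤ 1) := by
  induction w with
  | nil => exact ⟨[], [], by simp [splitOnP_nil], by simp [Preceded], by simp [Dissimilated]⟩
  | cons x w ih =>
    obtain ⟨h, t, hs, hp, hd⟩ := ih
    rw [preceded_cons hlr, dissimilated_cons, hp, hd]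
    by_cases hx : x = r
    · refine ⟨[], h :: t, by simp [splitOnP_cons_eq_if_splitOnPPrepend, hx, hs], by simp [hx], ?_⟩
      simp [hx, hlr.symm]
    · refine ⟨x :: h, t, ?_, ?_, ?_⟩
      · simp [splitOnP_cons_eq_if_splitOnPPrepend, splitOnPPrepend_eq_modifyHead, hx, hs]
      · by_cases hl : x = l <;> simp [hx, hl, hlr]
      · simp only [forall_mem_cons, count_cons, beq_iff_eq]
        split_ifs with hl <;> grind

theorem dissimilated_iff_get {α : Type*} (l r : α) (w : List α) :
    Dissimilated l r w ↔ ∀ i j : Fin w.length, i < j → w.get i = l → w.get j = l →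
      ∃ k : Fin w.length, i < k ∧ k < j ∧ w.get k = r := by
  constructor
  · intro h i j hij hi hj
    obtain ⟨k, hik, hkj, hr⟩ := h i j hij (by simpa using hi) (by simpa using hj)
    obtain ⟨hk, hr⟩ := getElem?_eq_some_iff.1 hr
    exact ⟨⟨k, hk⟩, hik, hkj, hr⟩
  · intro h i j hij hi hj
    obtain ⟨hi', hi⟩ := getElem?_eq_some_iff.1 hi
    obtain ⟨hj', hj⟩ := getElem?_eq_some_iff.1 hj
    obtain ⟨k, hik, hkj, hr⟩ := h ⟨i, hi'⟩ ⟨j, hj'⟩ hij hi hj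
    exact ⟨k, hik, hkj, by simpa using hr⟩

end List

/-- The dissimilation formula
`∀x ∀y [(R_l(x) ∧ R_l(y) ∧ x < y) → ∃z (R_r(z) ∧ x < z ∧ z < y)]` is true in
the precedence model of `w` iff every maximal segment of `w` containing no
occurrence of `r` (i.e. every block of `w.splitOnP (· = r)`) contains at
most one occurrence of `l`. -/
theorem dissimilation_iff_blocks_count_le_one
    {α : Type*} [DecidableEq α] (l r : α) (hlr : l ≠ r) (w : List α) :
    (∀ i j : Fin w.length, i < j → w.get i = l → w.get j = l →
        ∃ k : Fin w.length, i < k ∧ k < j ∧ w.get k = r) ↔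
      ∀ s ∈ w.splitOnP (· = r), s.count l ≤ 1 := by
  obtain ⟨h, t, hs, -, hd⟩ := List.exists_splitOnP_eq_cons_of_ne hlr w
  rw [hs, ← hd, List.dissimilated_iff_get]
end

section
/- Let N be a positive integer, let l, r : Fin N → ℝ be indicator vectors with l i ∈ {0,1} and r i ∈ {0,1} for all i, and let P : Fin N → Fin N → ℝ with P i j = if i < j then 1 else 0 encode the precedence relation. With min₁(x) := min x 1, set A i j := (l i) * (l j) * (P i j) and B i j k := (r k) * (P i k) * (P k j). Then the compositional tensor evaluation of the dissimilation formula ∀x ∀y [A → ∃z B], namely V := 1 - min₁( ∑ i, (1 - (1 - min₁( ∑ j, (1 - min₁((1 - A i j) + min₁(∑ k, B i j k)))))) ), lies in {0, 1}, and V = 1 if and only if for all i, j : Fin N with l i = 1, l j = 1 and i < j, there exists k : Fin N with i < k, k < j and r k = 1. -/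
/-- The truncated sum of indicators is the indicator of the existential quantification. -/
theorem min_sum_indicator_one {ι : Type*} [Fintype ι] (p : ι → Prop)
    [DecidablePred p] [Decidable (∃ i, p i)] (f : ι → ℝ)
    (hf : ∀ i, f i = if p i then 1 else 0) :
    min (∑ i, f i) 1 = if ∃ i, p i then 1 else 0 := by
  have hnonneg : ∀ i, 0 ≤ f i := fun i => by rw [hf]; split_ifs <;> norm_num
  split_ifs with h
  · obtain ⟨i, hi⟩ := h
    refine min_eq_right ?_
    calc (1 : ℝ) = f i := by rw [hf, if_pos hi]
      _ ≤ ∑ i, f i := Finset.single_le_sum (fun j _ => hnonneg j) (Finset.mem_univ i)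
  · have hzero : ∑ i, f i = 0 :=
      Finset.sum_eq_zero fun i _ => by rw [hf, if_neg fun hi => h ⟨i, hi⟩]
    rw [hzero]
    exact min_eq_left zero_le_one

/-- The compositional tensor evaluation of the dissimilation formula
`∀x ∀y [A → ∃z B]`, with `A i j = l i * l j * P i j` and
`B i j k = r k * P i k * P k j`, lies in `{0,1}`, and equals `1` iff for
all `i j` with `l i = 1`, `l j = 1` and `i < j` there is `k` with `i < k`,
`k < j` and `r k = 1`. -/
theorem dissimilation_tensor_evaluation
    (N : ℕ) (hN : 0 < N) (l r : Fin N → ℝ)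
    (hl : ∀ i, l i = 0 ∨ l i = 1) (hr : ∀ i, r i = 0 ∨ r i = 1)
    (P : Fin N → Fin N → ℝ) (hP : ∀ i j, P i j = if i < j then 1 else 0)
    (A : Fin N → Fin N → ℝ) (hA : ∀ i j, A i j = (l i) * (l j) * (P i j))
    (B : Fin N → Fin N → Fin N → ℝ)
    (hB : ∀ i j k, B i j k = (r k) * (P i k) * (P k j))
    (V : ℝ)
    (hV : V = 1 - min (∑ i, (1 - (1 - min (∑ j,
        (1 - min ((1 - A i j) + min (∑ k, B i j k) 1) 1)) 1))) 1) :
    (V = 0 ∨ V = 1) ∧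
    (V = 1 ↔ ∀ i j : Fin N, l i = 1 → l j = 1 → i < j →
        ∃ k : Fin N, i < k ∧ k < j ∧ r k = 1) := by
  classical
  have hex : ∀ i j, min (∑ k, B i j k) 1 = if ∃ k, i < k ∧ k < j ∧ r k = 1 then 1 else 0 := by
    intro i j
    refine min_sum_indicator_one (fun k => i < k ∧ k < j ∧ r k = 1) _ fun k => ?_
    rw [hB, hP, hP]
    rcases hr k with h | h <;> by_cases hik : i < k <;> by_cases hkj : k < j <;>
      simp [h, hik, hkj]
  have hA' : ∀ i j, A i j = if l i = 1 ∧ l j = 1 ∧ i < j then 1 else 0 := by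
    intro i j
    rw [hA, hP]
    rcases hl i with h | h <;> rcases hl j with h' | h' <;> simp [h, h']
  have himp : ∀ i j, 1 - min ((1 - A i j) + min (∑ k, B i j k) 1) 1 =
      if (l i = 1 ∧ l j = 1 ∧ i < j) ∧ ¬ ∃ k, i < k ∧ k < j ∧ r k = 1 then 1 else 0 := by
    intro i j
    rw [hex, hA']
    by_cases h : l i = 1 ∧ l j = 1 ∧ i < j <;>
      by_cases h' : ∃ k, i < k ∧ k < j ∧ r k = 1 <;>
      simp only [h, h', if_true, if_false, not_true, not_false_eq_true, and_self, and_true,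
        and_false] <;> norm_num
  have h_viol : ∀ i, 1 - (1 - min (∑ j,
      (1 - min ((1 - A i j) + min (∑ k, B i j k) 1) 1)) 1) =
      if ∃ j, (l i = 1 ∧ l j = 1 ∧ i < j) ∧ ¬ ∃ k, i < k ∧ k < j ∧ r k = 1 then 1 else 0 := by
    intro i
    rw [sub_sub_cancel]
    exact min_sum_indicator_one
      (fun j => (l i = 1 ∧ l j = 1 ∧ i < j) ∧ ¬ ∃ k, i < k ∧ k < j ∧ r k = 1) _ (himp i)
  rw [min_sum_indicator_one
    (fun i => ∃ j, (l i = 1 ∧ l j = 1 ∧ i < j) ∧ ¬ ∃ k, i < k ∧ k < j ∧ r k = 1) _ h_viol] at hV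
  split_ifs at hV with h
  · have hV0 : V = 0 := by rw [hV, sub_self]
    refine ⟨Or.inl hV0, fun hV1 => absurd (hV0.symm.trans hV1) zero_ne_one, fun hforall => ?_⟩
    obtain ⟨i, j, ⟨hi, hj, hij⟩, hno⟩ := h
    exact absurd (hforall i j hi hj hij) hno
  · have hV1 : V = 1 := by rw [hV, sub_zero]
    refine ⟨Or.inr hV1, fun _ i j hi hj hij => ?_, fun _ => hV1⟩
    by_contra hno
    exact h ⟨i, j, ⟨hi, hj, hij⟩, hno⟩
end
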